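/- arXiv:1903.00236 — 2 statements merged into one kernel-verified Lean document; each statement's English description precedes it below -/
import Mathlib

section
/- Let f : ℝ^d×ℝ^m×[0,T] → ℝ^d be continuous, 1 < p < ∞ and 1 ≤ q < +∞. Then the Nemytskii operator (x(·),u(·)) ↦ f(x(·),u(·),·) maps L^∞_d(0,T) × L^q_m(0,T) into L^p_d(0,T) if and only if for every R > 0 there exist C_R > 0 and an a.e. nonnegative function ω_R ∈ L^p(0,T) such that |f(x,u,t)| ≤ C_R|u|^{q/p} + ω_R(t) for a.e. t ∈ [0,T] and all (x,u) ∈ ℝ^d×ℝ^m with |x| ≤ R. Moreover, if this condition holds, then the operator F(x,u) = ẋ(·) − f(x(·),u(·),·) is a continuous nonlinear operator from W^{1,p}_d(0,T) × L^q_m(0,T) into L^p_d(0,T). -/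
open MeasureTheory Set Filter Topology
open scoped ENNReal NNReal

noncomputable section

/-- `ℝ^n` as a Euclidean space. -/
abbrev Vec (n : ℕ) := EuclideanSpace ℝ (Fin n)

/-- Lebesgue measure restricted to the interval `(0, T]`. -/
noncomputable def muT (T : ℝ) : Measure ℝ := volume.restrict (Set.Ioc 0 T)

/-- Membership in `W^{1,p}_d(0,T)`: `x` is absolutely continuous on `[0,T]` with derivative
`x' ∈ L^p`. -/
def InW {d : ℕ} (T p : ℝ) (x x' : ℝ → Vec d) : Prop :=
  IntervalIntegrable x' volume 0 T ∧
  (∀ t ∈ Set.Icc 0 T, x t = x 0 + ∫ s in (0:ℝ)..t, x' s) ∧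
  MemLp x' (ENNReal.ofReal p) (muT T)

/-- A finite measure on the line vanishing on singletons attains every intermediate value on
left half-lines. -/
lemma exists_measure_Iic_eq (ν : Measure ℝ) [IsFiniteMeasure ν] [NullSingletonClass ν]
    {c : ℝ≥0∞} (hc0 : 0 < c) (hc : c < ν univ) : ∃ s, ν (Iic s) = c := by
  have hct : c ≠ ⊤ := ne_top_of_lt hc
  have hcont : Continuous fun s => ν.real (Iic s) := by
    rw [continuous_iff_continuousAt]
    intro s
    have h := IntegrableOn.continuousOn_Iic_primitive_Iic (μ := ν)
      (f := fun _ : ℝ => (1 : ℝ)) (a₀ := s + 1) (integrableOn_const (measure_ne_top _ _))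
    have h2 : (fun t => ∫ _ in Iic t, (1 : ℝ) ∂ν) = fun s => ν.real (Iic s) := by
      ext t; simp
    rw [h2] at h
    exact h.continuousAt (Iic_mem_nhds (by linarith))
  have htop : Tendsto (fun s => ν (Iic s)) atTop (𝓝 (ν univ)) := tendsto_measure_Iic_atTop ν
  have hbot : Tendsto (fun s => ν (Iic s)) atBot (𝓝 0) := by
    have h := tendsto_measure_iInter_atBot (μ := ν) (s := fun s : ℝ => Iic s)
      (fun s => measurableSet_Iic.nullMeasurableSet) (fun a b h => Iic_subset_Iic.2 h)
      ⟨0, measure_ne_top _ _⟩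
    have he : ⋂ s : ℝ, Iic s = ∅ := by
      ext x; simp only [mem_iInter, mem_Iic, mem_empty_iff_false, iff_false, not_forall, not_le]
      exact ⟨x - 1, by linarith⟩
    simpa [he, Function.comp_def] using h
  obtain ⟨b, hb⟩ := (htop.eventually (lt_mem_nhds hc)).exists
  obtain ⟨a, ha⟩ := (hbot.eventually (gt_mem_nhds hc0)).exists
  have hmem : c.toReal ∈ Icc (ν.real (Iic a)) (ν.real (Iic b)) :=
    ⟨ENNReal.toReal_mono hct ha.le, ENNReal.toReal_mono (measure_ne_top _ _) hb.le⟩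
  obtain ⟨s, hs⟩ := mem_range_of_exists_le_of_exists_ge hcont ⟨a, hmem.1⟩ ⟨b, hmem.2⟩
  exact ⟨s, (ENNReal.toReal_eq_toReal_iff' (measure_ne_top _ _) hct).1 hs⟩

/-- A finite measure on the line of mass above two, vanishing on singletons, has two disjoint sets
of measure one. -/
lemma exists_disjoint_measure_eq_one (ν : Measure ℝ) [IsFiniteMeasure ν] [NullSingletonClass ν]
    (h : 2 < ν univ) : ∃ E₁ E₂ : Set ℝ, MeasurableSet E₁ ∧ MeasurableSet E₂ ∧ Disjoint E₁ E₂ ∧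
      ν E₁ = 1 ∧ ν E₂ = 1 := by
  obtain ⟨s, hs⟩ := exists_measure_Iic_eq ν one_pos (lt_trans ENNReal.one_lt_two h)
  obtain ⟨t, ht⟩ := exists_measure_Iic_eq ν two_pos h
  have hst : Iic s ⊆ Iic t := by
    rcases le_total s t with h | h
    · exact Iic_subset_Iic.2 h
    · have := measure_mono (μ := ν) (Iic_subset_Iic.2 h)
      rw [hs, ht] at this
      exact absurd this (by simp)
  refine ⟨Iic s, Iic t \ Iic s, measurableSet_Iic, measurableSet_Iic.diff measurableSet_Iic,
    disjoint_sdiff_right, hs, ?_⟩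
  rw [measure_sdiff hst measurableSet_Iic.nullMeasurableSet (measure_ne_top _ _), hs, ht,
    ← one_add_one_eq_two, ENNReal.add_sub_cancel_right ENNReal.one_ne_top]

/-- Finitely many measurable functions admit a measurable selection of a maximizing index. -/
lemma exists_measurable_argmax {α β : Type*} [MeasurableSpace α] [LinearOrder β]
    [TopologicalSpace β] [OrderClosedTopology β] [SecondCountableTopology β] [MeasurableSpace β]
    [OpensMeasurableSpace β] (v : ℕ → α → β) (hv : ∀ i, Measurable (v i)) (n : ℕ) :
    ∃ idx : α → ℕ, Measurable idx ∧ (∀ t, idx t ≤ n) ∧ ∀ t, ∀ i ≤ n, v i t ≤ v (idx t) t := by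
  induction n with
  | zero => exact ⟨fun _ => 0, measurable_const, fun _ => le_rfl, fun t i hi => by
      rw [Nat.le_zero.1 hi]⟩
  | succ n ih =>
    obtain ⟨idx, hm, hle, hmax⟩ := ih
    have hvi : Measurable fun t => v (idx t) t :=
      (measurable_from_prod_countable_left (f := fun z : α × ℕ => v z.2 z.1) hv).comp
        (measurable_id.prodMk hm)
    refine ⟨fun t => if v (idx t) t < v (n + 1) t then n + 1 else idx t,
      Measurable.ite (measurableSet_lt hvi (hv _)) measurable_const hm, fun t => ?_,
      fun t i hi => ?_⟩
    · dsimp only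
      split_ifs
      · exact le_rfl
      · exact (hle t).trans n.le_succ
    · dsimp only
      rcases Nat.le_succ_iff.1 hi with h | rfl
      · split_ifs with hlt
        · exact (hmax t i h).trans hlt.le
        · exact hmax t i h
      · split_ifs with hlt
        · exact le_rfl
        · exact not_lt.1 hlt

/-- If `∫ sup_i (G i - k c i) = ∞` on `A`, some measurable selection of indices carries unit
`G`-mass on two disjoint subsets of `A`, where `k c ≤ G`. -/
lemma exists_selection_unit_mass {μ : Measure ℝ} [IsFiniteMeasure μ] [NullSingletonClass μ]
    {G : ℕ → ℝ → ℝ≥0∞} (hG : ∀ i, Measurable (G i)) (hGint : ∀ i, ∫⁻ t, G i t ∂μ ≠ ⊤)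
    {c : ℕ → ℝ≥0∞} {k : ℝ≥0∞} {A : Set ℝ} (hA : MeasurableSet A)
    (h : ∫⁻ t in A, ⨆ i, (G i t - k * c i) ∂μ = ⊤) :
    ∃ idx : ℝ → ℕ, Measurable idx ∧ ∃ E₁ E₂ : Set ℝ, MeasurableSet E₁ ∧ MeasurableSet E₂ ∧
      Disjoint E₁ E₂ ∧ E₁ ⊆ A ∧ E₂ ⊆ A ∧
      (∀ t ∈ E₁ ∪ E₂, k * c (idx t) ≤ G (idx t) t) ∧
      ∫⁻ t in E₁, G (idx t) t ∂μ = 1 ∧ ∫⁻ t in E₂, G (idx t) t ∂μ = 1 := by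
  have hv : ∀ i, Measurable fun t => G i t - k * c i := fun i => (hG i).sub_const _
  have hsup : ∀ t, ⨆ i, (G i t - k * c i) = ⨆ n, ⨆ i ≤ n, (G i t - k * c i) := fun t =>
    (biSup_le_eq_iSup (f := fun i => G i t - k * c i)).symm
  simp_rw [hsup] at h
  rw [lintegral_iSup (fun n => Measurable.iSup fun i => Measurable.iSup fun _ => hv i)
    (fun a b hab t => iSup_mono fun i => iSup_mono' fun hi => ⟨hi.trans hab, le_rfl⟩)] at h
  obtain ⟨n, hn⟩ := lt_iSup_iff.1 (h ▸ ENNReal.ofNat_lt_top : (2 : ℝ≥0∞) < _)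
  obtain ⟨idx, hidx, hle, hmax⟩ := exists_measurable_argmax _ hv n
  have hGi : Measurable fun t => G (idx t) t :=
    (measurable_from_prod_countable_left (f := fun z : ℝ × ℕ => G z.2 z.1) hG).comp
      (measurable_id.prodMk hidx)
  have hci : Measurable fun t => c (idx t) := (measurable_of_countable c).comp hidx
  set D : Set ℝ := A ∩ {t | k * c (idx t) ≤ G (idx t) t} with hD
  have hDm : MeasurableSet D := hA.inter (measurableSet_le (hci.const_mul k) hGi)
  set ν := (μ.restrict D).withDensity fun t => G (idx t) t with hν
  have hνE : ∀ E, MeasurableSet E → ν E = ∫⁻ t in E ∩ D, G (idx t) t ∂μ := fun E hE => by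
    rw [hν, withDensity_apply _ hE, Measure.restrict_restrict hE]
  have hfin : ∫⁻ t, G (idx t) t ∂μ ≠ ⊤ := by
    refine ne_top_of_le_ne_top (ENNReal.sum_ne_top.2 fun i (_ : i ∈ Finset.range (n + 1)) =>
      hGint i) ?_
    rw [← lintegral_finsetSum _ fun i _ => hG i]
    exact lintegral_mono fun t => Finset.single_le_sum (f := fun i => G i t)
      (fun _ _ => zero_le) (Finset.mem_range.2 (Nat.lt_succ_of_le (hle t)))
  have : IsFiniteMeasure ν := isFiniteMeasure_withDensity
    (ne_top_of_le_ne_top hfin (setLIntegral_le_lintegral _ _))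
  have hν2 : 2 < ν univ := by
    refine hn.trans_le ?_
    rw [hνE _ MeasurableSet.univ, univ_inter, ← lintegral_indicator hA, ← lintegral_indicator hDm]
    refine lintegral_mono fun t => ?_
    by_cases htA : t ∈ A
    · rw [indicator_of_mem htA]
      refine iSup₂_le fun i hi => (hmax t i hi).trans ?_
      by_cases htD : k * c (idx t) ≤ G (idx t) t
      · rw [indicator_of_mem (show t ∈ D from ⟨htA, htD⟩)]
        exact tsub_le_self
      · rw [tsub_eq_zero_of_le (not_le.1 htD).le]
        exact zero_le
    · rw [indicator_of_notMem htA]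
      exact zero_le
  obtain ⟨E₁, E₂, hm₁, hm₂, hd, h₁, h₂⟩ := exists_disjoint_measure_eq_one ν hν2
  refine ⟨idx, hidx, E₁ ∩ D, E₂ ∩ D, hm₁.inter hDm, hm₂.inter hDm,
    hd.mono inter_subset_left inter_subset_left, fun t ht => ht.2.1, fun t ht => ht.2.1, ?_,
    (hνE _ hm₁) ▸ h₁, (hνE _ hm₂) ▸ h₂⟩
  rintro t (ht | ht)
  · exact ht.2.2
  · exact ht.2.2

/-- Removing a set of unit `G`-mass from a set where every `∫ sup_i (G i - k c i)` diverges can be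
done keeping the divergence. -/
lemma exists_selection_remainder {μ : Measure ℝ} [IsFiniteMeasure μ] [NullSingletonClass μ]
    {G : ℕ → ℝ → ℝ≥0∞} (hG : ∀ i, Measurable (G i)) (hGint : ∀ i, ∫⁻ t, G i t ∂μ ≠ ⊤)
    {c : ℕ → ℝ≥0∞} {A : Set ℝ} (hA : MeasurableSet A)
    (h : ∀ k : ℕ, ∫⁻ t in A, ⨆ i, (G i t - k * c i) ∂μ = ⊤) (k : ℕ) :
    ∃ idx : ℝ → ℕ, Measurable idx ∧ ∃ E : Set ℝ, MeasurableSet E ∧ E ⊆ A ∧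
      (∀ t ∈ E, k * c (idx t) ≤ G (idx t) t) ∧ ∫⁻ t in E, G (idx t) t ∂μ = 1 ∧
      ∀ k : ℕ, ∫⁻ t in A \ E, ⨆ i, (G i t - k * c i) ∂μ = ⊤ := by
  obtain ⟨idx, hidx, E₁, E₂, hm₁, hm₂, hd, hs₁, hs₂, hle, h₁, h₂⟩ :=
    exists_selection_unit_mass hG hGint hA (h k)
  by_cases hE₁ : ∀ k : ℕ, ∫⁻ t in A \ E₁, ⨆ i, (G i t - k * c i) ∂μ = ⊤
  · exact ⟨idx, hidx, E₁, hm₁, hs₁, fun t ht => hle t (Or.inl ht), h₁, hE₁⟩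
  refine ⟨idx, hidx, E₂, hm₂, hs₂, fun t ht => hle t (Or.inr ht), h₂, fun l => ?_⟩
  push Not at hE₁
  obtain ⟨l', hl'⟩ := hE₁
  by_contra hl
  have hanti : ∀ (B : Set ℝ) (a b : ℕ), a ≤ b → ∫⁻ t in B, ⨆ i, (G i t - b * c i) ∂μ ≤
      ∫⁻ t in B, ⨆ i, (G i t - a * c i) ∂μ := fun B a b hab =>
    lintegral_mono fun t => iSup_mono fun i => tsub_le_tsub_left (by gcongr) _
  have hcover : A ⊆ (A \ E₁) ∪ (A \ E₂) := fun t ht => by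
    by_cases h1 : t ∈ E₁
    · exact Or.inr ⟨ht, disjoint_left.1 hd h1⟩
    · exact Or.inl ⟨ht, h1⟩
  refine (ENNReal.add_ne_top.2 ⟨
    ne_top_of_le_ne_top hl' (hanti (A \ E₁) _ (max l' l) (le_max_left _ _)),
    ne_top_of_le_ne_top hl (hanti (A \ E₂) _ (max l' l) (le_max_right _ _))⟩) ?_
  rw [eq_top_iff, ← h (max l' l)]
  exact (lintegral_mono_set hcover).trans (lintegral_union_le _ _ _)

/-- If every measurable selection with `∫ c < ∞` satisfies `∫ G < ∞`, then
`∫ sup_i (G i - k c i) < ∞` for some `k`. -/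
lemma exists_lintegral_iSup_sub_ne_top {μ : Measure ℝ} [IsFiniteMeasure μ] [NullSingletonClass μ]
    {G : ℕ → ℝ → ℝ≥0∞} (hG : ∀ i, Measurable (G i)) {c : ℕ → ℝ≥0∞} (hc : ∀ i, c i ≠ ⊤)
    (h : ∀ idx : ℝ → ℕ, Measurable idx → ∫⁻ t, c (idx t) ∂μ ≠ ⊤ →
      ∫⁻ t, G (idx t) t ∂μ ≠ ⊤) :
    ∃ k : ℕ, ∫⁻ t, ⨆ i, (G i t - k * c i) ∂μ ≠ ⊤ := by
  by_contra! hcon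
  have hGint : ∀ i, ∫⁻ t, G i t ∂μ ≠ ⊤ := fun i => h (fun _ => i) measurable_const (by
    rw [lintegral_const]
    exact ENNReal.mul_ne_top (hc i) (measure_ne_top _ _))
  let S := {A : Set ℝ // MeasurableSet A ∧
    ∀ k : ℕ, ∫⁻ t in A, ⨆ i, (G i t - k * c i) ∂μ = ⊤}
  have step : ∀ (A : S) (k : ℕ), ∃ idx : ℝ → ℕ, Measurable idx ∧ ∃ E : Set ℝ, MeasurableSet E ∧
      E ⊆ A.1 ∧ (∀ t ∈ E, k * c (idx t) ≤ G (idx t) t) ∧ ∫⁻ t in E, G (idx t) t ∂μ = 1 ∧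
      ∀ k : ℕ, ∫⁻ t in A.1 \ E, ⨆ i, (G i t - k * c i) ∂μ = ⊤ := fun A k =>
    exists_selection_remainder hG hGint A.2.1 A.2.2 k
  choose idx hidx E hEm hEA hcG hEone hrem using step
  let A : ℕ → S := fun n => Nat.rec ⟨univ, MeasurableSet.univ, by simpa using hcon⟩
    (fun n B => ⟨B.1 \ E B (2 ^ n), B.2.1.diff (hEm _ _), hrem _ _⟩) n
  have hAsucc : ∀ n, (A (n + 1)).1 = (A n).1 \ E (A n) (2 ^ n) := fun n => rfl
  have hAanti : Antitone fun n => (A n).1 := antitone_nat_of_succ_le fun n => by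
    rw [hAsucc]; exact sdiff_subset
  let e : ℕ → Set ℝ := fun n => E (A n) (2 ^ n)
  have hem : ∀ n, MeasurableSet (e n) := fun n => hEm _ _
  have hlt : ∀ m n, m < n → Disjoint (e m) (e n) := fun m n hmn => by
    have h1 : e n ⊆ (A m).1 \ e m := (hEA (A n) _).trans (hAanti (Nat.succ_le_of_lt hmn))
    exact disjoint_left.2 fun t ht ht' => (h1 ht').2 ht
  have hdisj : Pairwise (Function.onFun Disjoint e) := fun m n hmn => by
    rcases lt_or_gt_of_ne hmn with h | h
    · exact hlt m n h
    · exact (hlt n m h).symm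
  obtain ⟨g, hgm, hg⟩ := exists_measurable_piecewise e hem (fun n => idx (A n) (2 ^ n))
    (fun n => hidx _ _) (fun m n hmn t ht => absurd ht.2 (disjoint_left.1 (hdisj hmn) ht.1))
  have hUm : MeasurableSet (⋃ n, e n) := MeasurableSet.iUnion hem
  classical
  let σ : ℝ → ℕ := (⋃ n, e n).piecewise g fun _ => 0
  have hσm : Measurable σ := hgm.piecewise hUm measurable_const
  have hσ : ∀ n, ∀ t ∈ e n, σ t = idx (A n) (2 ^ n) t := fun n t ht => by
    rw [← hg n ht]
    exact piecewise_eq_of_mem _ _ _ (mem_iUnion.2 ⟨n, ht⟩)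
  have hGσ : ∀ n, ∫⁻ t in e n, G (σ t) t ∂μ = 1 := fun n => by
    rw [← hEone (A n) (2 ^ n)]
    exact setLIntegral_congr_fun (hem n) fun t ht => by simp only [hσ n t ht]
  refine h σ hσm ?_ ?_
  · rw [← lintegral_add_compl _ hUm, lintegral_iUnion hem hdisj]
    refine ENNReal.add_ne_top.2 ⟨?_, ?_⟩
    · have hle : ∀ n, ∫⁻ t in e n, c (σ t) ∂μ ≤ (2⁻¹ : ℝ≥0∞) ^ n := fun n => by
        have h2 : (2 : ℝ≥0∞) ^ n ≠ 0 := by positivity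
        have h2t : (2 : ℝ≥0∞) ^ n ≠ ⊤ := by finiteness
        rw [← ENNReal.inv_pow, ← one_div, ENNReal.le_div_iff_mul_le (Or.inl h2) (Or.inl h2t),
          mul_comm, ← hGσ n, ← lintegral_const_mul' _ _ h2t]
        refine setLIntegral_mono' (hem n) fun t ht => ?_
        rw [hσ n t ht]
        simpa using hcG (A n) (2 ^ n) t ht
      refine ne_top_of_le_ne_top ?_ (ENNReal.tsum_le_tsum hle)
      rw [ENNReal.tsum_geometric, ENNReal.one_sub_inv_two, inv_inv]
      exact ENNReal.ofNat_ne_top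
    · rw [setLIntegral_congr_fun hUm.compl (g := fun _ => c 0) fun t ht => by
        simp only [σ, piecewise_eq_of_notMem _ _ _ ht], setLIntegral_const]
      exact ENNReal.mul_ne_top (hc 0) (measure_ne_top _ _)
  · rw [eq_top_iff]
    calc (⊤ : ℝ≥0∞) = ∑' _ : ℕ, (1 : ℝ≥0∞) :=
          (ENNReal.tsum_const_eq_top_of_ne_zero one_ne_zero).symm
      _ = ∫⁻ t in ⋃ n, e n, G (σ t) t ∂μ := by
        rw [lintegral_iUnion hem hdisj]; exact tsum_congr fun n => (hGσ n).symm
      _ ≤ _ := setLIntegral_le_lintegral _ _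

section Caratheodory

variable {α X U Y : Type*} [MeasurableSpace α] {μ : Measure α}
  [NormedAddCommGroup X] [NormedAddCommGroup U] [NormedAddCommGroup Y]

lemma lintegral_rpow_enorm_ne_top {g : α → Y} {p : ℝ} (hp : 0 < p)
    (h : MemLp g (ENNReal.ofReal p) μ) : ∫⁻ t, ‖g t‖ₑ ^ p ∂μ ≠ ⊤ := by
  have h2 := (eLpNorm_lt_top_iff_lintegral_rpow_enorm_lt_top (ENNReal.ofReal_pos.2 hp).ne'
    ENNReal.ofReal_ne_top).1 h.2
  rw [ENNReal.toReal_ofReal hp.le] at h2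
  exact h2.ne

lemma memLp_of_lintegral_rpow_enorm_ne_top {g : α → Y} {p : ℝ} (hp : 0 < p)
    (hg : AEStronglyMeasurable g μ) (h : ∫⁻ t, ‖g t‖ₑ ^ p ∂μ ≠ ⊤) :
    MemLp g (ENNReal.ofReal p) μ := by
  refine ⟨hg, (eLpNorm_lt_top_iff_lintegral_rpow_enorm_lt_top (ENNReal.ofReal_pos.2 hp).ne'
    ENNReal.ofReal_ne_top).2 ?_⟩
  rw [ENNReal.toReal_ofReal hp.le]
  exact h.lt_top

/-- The `p`-th root of an integrable nonnegative function is in `L^p`. -/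
lemma memLp_toReal_rpow_inv {h : α → ℝ≥0∞} {p : ℝ} (hp : 0 < p) (hh : AEMeasurable h μ)
    (hint : ∫⁻ t, h t ∂μ ≠ ⊤) :
    MemLp (fun t => (h t ^ (1 / p)).toReal) (ENNReal.ofReal p) μ := by
  refine memLp_of_lintegral_rpow_enorm_ne_top hp
    (hh.pow_const _).ennreal_toReal.aestronglyMeasurable
    (ne_top_of_le_ne_top hint (lintegral_mono fun t => ?_))
  calc ‖(h t ^ (1 / p)).toReal‖ₑ ^ p ≤ (h t ^ (1 / p)) ^ p := by
        gcongr
        rw [Real.enorm_of_nonneg ENNReal.toReal_nonneg]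
        exact ENNReal.ofReal_toReal_le
    _ = h t := by rw [← ENNReal.rpow_mul, one_div_mul_cancel hp.ne', ENNReal.rpow_one]

/-- Dominated convergence in `L^p`. -/
lemma tendsto_eLpNorm_zero_of_dominated {g : ℕ → α → Y} {D : α → ℝ} {p : ℝ} (hp : 0 < p)
    (hg : ∀ n, AEStronglyMeasurable (g n) μ) (hD : MemLp D (ENNReal.ofReal p) μ)
    (hle : ∀ᵐ t ∂μ, ∀ n, ‖g n t‖ ≤ D t)
    (hlim : ∀ᵐ t ∂μ, Tendsto (fun n => g n t) atTop (𝓝 0)) :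
    Tendsto (fun n => eLpNorm (g n) (ENNReal.ofReal p) μ) atTop (𝓝 0) := by
  have h1 : Tendsto (fun n => ∫⁻ t, ‖g n t‖ₑ ^ p ∂μ) atTop (𝓝 (∫⁻ _, 0 ∂μ)) := by
    refine tendsto_lintegral_of_dominated_convergence' (fun t => ‖D t‖ₑ ^ p)
      (fun n => (hg n).enorm.pow_const p) (fun n => ?_) (lintegral_rpow_enorm_ne_top hp hD) ?_
    · filter_upwards [hle] with t ht
      gcongr
      exact enorm_le_iff_norm_le.2 ((ht n).trans (le_abs_self _))
    · filter_upwards [hlim] with t ht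
      have := ((ENNReal.continuous_rpow_const (y := p)).tendsto _).comp ht.enorm
      simpa [ENNReal.zero_rpow_of_pos hp, Function.comp_def] using this
  have h2 := ((ENNReal.continuous_rpow_const (y := 1 / p)).tendsto _).comp h1
  simp only [lintegral_zero, ENNReal.zero_rpow_of_pos (one_div_pos.2 hp)] at h2
  refine h2.congr fun n => ?_
  rw [eLpNorm_eq_lintegral_rpow_enorm_toReal (ENNReal.ofReal_pos.2 hp).ne' ENNReal.ofReal_ne_top,
    ENNReal.toReal_ofReal hp.le]
  rfl

lemma memLp_norm_rpow_div_ofReal {u : α → U} {p q : ℝ} (hp : 0 < p) (hq : 0 < q)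
    (hu : MemLp u (ENNReal.ofReal q) μ) :
    MemLp (fun t => ‖u t‖ ^ (q / p)) (ENNReal.ofReal p) μ := by
  have h := hu.norm_rpow_div (ENNReal.ofReal (q / p))
  rwa [ENNReal.toReal_ofReal (div_pos hq hp).le, ← ENNReal.ofReal_div_of_pos (div_pos hq hp),
    div_div_cancel₀ hq.ne'] at h

/-- A growth bound of order `q / p` makes the superposition of a bounded function and an `L^q`
function an `L^p` function. -/
lemma memLp_comp_of_growth {f : X → U → α → Y} {p q C R : ℝ} (hp : 0 < p) (hq : 0 < q)
    {ω : α → ℝ} (hω : MemLp ω (ENNReal.ofReal p) μ)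
    (hgrowth : ∀ᵐ t ∂μ, ∀ a b, ‖a‖ ≤ R → ‖f a b t‖ ≤ C * ‖b‖ ^ (q / p) + ω t)
    {x : α → X} {u : α → U} (hx : ∀ᵐ t ∂μ, ‖x t‖ ≤ R) (hu : MemLp u (ENNReal.ofReal q) μ)
    (hm : AEStronglyMeasurable (fun t => f (x t) (u t) t) μ) :
    MemLp (fun t => f (x t) (u t) t) (ENNReal.ofReal p) μ := by
  refine (((memLp_norm_rpow_div_ofReal hp hq hu).const_mul C).add hω).mono' hm ?_
  filter_upwards [hgrowth, hx] with t ht hxt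
  exact ht _ _ hxt

/-- Sequential continuity of a superposition operator under a growth bound, for rapidly
convergent sequences of controls. -/
lemma tendsto_eLpNorm_comp_sub {f : X → U → α → Y} {p q C R : ℝ} (hp : 0 < p) (hq : 1 ≤ q)
    (hC : 0 ≤ C)
    (hcont : ∀ᵐ t ∂μ, Continuous fun z : X × U => f z.1 z.2 t)
    (hmeas : ∀ (x : α → X) (u : α → U), AEStronglyMeasurable x μ → AEStronglyMeasurable u μ →
      AEStronglyMeasurable (fun t => f (x t) (u t) t) μ)
    {ω : α → ℝ} (hω : MemLp ω (ENNReal.ofReal p) μ)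
    (hgrowth : ∀ᵐ t ∂μ, ∀ a b, ‖a‖ ≤ R → ‖f a b t‖ ≤ C * ‖b‖ ^ (q / p) + ω t)
    {x : α → X} {y : ℕ → α → X} (hxm : AEStronglyMeasurable x μ)
    (hym : ∀ n, AEStronglyMeasurable (y n) μ)
    (hx : ∀ᵐ t ∂μ, ‖x t‖ ≤ R) (hy : ∀ᵐ t ∂μ, ∀ n, ‖y n t‖ ≤ R)
    (hyx : ∀ᵐ t ∂μ, Tendsto (fun n => y n t) atTop (𝓝 (x t)))
    {u : α → U} {v : ℕ → α → U} (hu : MemLp u (ENNReal.ofReal q) μ)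
    (hv : ∀ n, MemLp (v n) (ENNReal.ofReal q) μ)
    (huv : ∀ n, eLpNorm (fun t => u t - v n t) (ENNReal.ofReal q) μ ≤ 2⁻¹ ^ n) :
    Tendsto (fun n => eLpNorm (fun t => f (x t) (u t) t - f (y n t) (v n t) t)
      (ENNReal.ofReal p) μ) atTop (𝓝 0) := by
  have hq0 : 0 < q := one_pos.trans_le hq
  set W : α → ℝ≥0∞ := fun t => ∑' n, ‖u t - v n t‖ₑ ^ q with hW
  have hwm : ∀ n, AEMeasurable (fun t => ‖u t - v n t‖ₑ ^ q) μ := fun n =>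
    (hu.1.sub (hv n).1).enorm.pow_const q
  have hWm : AEMeasurable W μ := AEMeasurable.tsum hwm
  have hWint : ∫⁻ t, W t ∂μ ≠ ⊤ := by
    rw [lintegral_tsum hwm]
    refine ne_top_of_le_ne_top (b := ∑' n : ℕ, (2⁻¹ : ℝ≥0∞) ^ n) ?_
      (ENNReal.tsum_le_tsum fun n => ?_)
    · rw [ENNReal.tsum_geometric, ENNReal.one_sub_inv_two, inv_inv]
      exact ENNReal.ofNat_ne_top
    · have h1 := huv n
      rw [eLpNorm_eq_lintegral_rpow_enorm_toReal (ENNReal.ofReal_pos.2 hq0).ne'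
        ENNReal.ofReal_ne_top, ENNReal.toReal_ofReal hq0.le, one_div,
        ENNReal.rpow_inv_le_iff hq0] at h1
      refine h1.trans ?_
      have h2 : ((2⁻¹ : ℝ≥0∞) ^ n) ≤ 1 := pow_le_one₀ zero_le (by simp)
      simpa using ENNReal.rpow_le_rpow_of_exponent_ge h2 hq
  set V : α → ℝ := fun t => ‖u t‖ + (W t ^ (1 / q)).toReal with hV
  have hVmem : MemLp V (ENNReal.ofReal q) μ :=
    hu.norm.add (memLp_toReal_rpow_inv hq0 hWm hWint)
  have hV0 : ∀ t, 0 ≤ V t := fun t => by positivity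
  have hWtop := ae_lt_top' hWm hWint
  have huV : ∀ t, ‖u t‖ ≤ V t := fun t => le_add_of_nonneg_right ENNReal.toReal_nonneg
  have hvV : ∀ᵐ t ∂μ, ∀ n, ‖v n t‖ ≤ V t := by
    filter_upwards [hWtop] with t ht n
    have h1 : ‖u t - v n t‖ₑ ≤ W t ^ (1 / q) := by
      rw [one_div, ENNReal.le_rpow_inv_iff hq0]
      exact ENNReal.le_tsum n
    have h2 : ‖u t - v n t‖ ≤ (W t ^ (1 / q)).toReal := by
      rw [← toReal_enorm]
      exact ENNReal.toReal_mono (ENNReal.rpow_ne_top_of_nonneg (by positivity) ht.ne) h1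
    calc ‖v n t‖ = ‖u t - (u t - v n t)‖ := by rw [sub_sub_cancel]
      _ ≤ ‖u t‖ + ‖u t - v n t‖ := norm_sub_le _ _
      _ ≤ V t := add_le_add le_rfl h2
  have hvu : ∀ᵐ t ∂μ, Tendsto (fun n => v n t) atTop (𝓝 (u t)) := by
    filter_upwards [hWtop] with t ht
    have h1 := ENNReal.tendsto_atTop_zero_of_tsum_ne_top ht.ne
    have h2 := ((ENNReal.continuous_rpow_const (y := 1 / q)).tendsto _).comp h1
    rw [ENNReal.zero_rpow_of_pos (one_div_pos.2 hq0)] at h2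
    have h3 : Tendsto (fun n => ‖u t - v n t‖ₑ) atTop (𝓝 0) := by
      refine h2.congr fun n => ?_
      simp only [Function.comp]
      rw [← ENNReal.rpow_mul, mul_one_div_cancel hq0.ne', ENNReal.rpow_one]
    have h4 : Tendsto (fun n => u t - v n t) atTop (𝓝 0) :=
      tendsto_zero_iff_norm_tendsto_zero.2 (by
        simpa [Function.comp_def] using (ENNReal.tendsto_toReal ENNReal.zero_ne_top).comp h3)
    simpa using h4.const_sub (u t)
  set D : α → ℝ := fun t => C * V t ^ (q / p) + ω t with hDdef
  have hD : MemLp D (ENNReal.ofReal p) μ := by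
    have h := memLp_norm_rpow_div_ofReal hp hq0 hVmem
    simp only [Real.norm_of_nonneg (hV0 _)] at h
    exact (h.const_mul C).add hω
  have hfD : ∀ᵐ t ∂μ, ∀ a b, ‖a‖ ≤ R → ‖b‖ ≤ V t → ‖f a b t‖ ≤ D t := by
    filter_upwards [hgrowth] with t ht a b ha hb
    refine (ht a b ha).trans ?_
    simp only [hDdef]
    gcongr
  refine tendsto_eLpNorm_zero_of_dominated hp (D := fun t => D t + D t)
    (fun n => (hmeas _ _ hxm hu.1).sub (hmeas _ _ (hym n) (hv n).1)) (hD.add hD) ?_ ?_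
  · filter_upwards [hfD, hx, hy, hvV] with t ht hxt hyt hvt n
    exact (norm_sub_le _ _).trans
      (add_le_add (ht _ _ hxt (huV t)) (ht _ _ (hyt n) (hvt n)))
  · filter_upwards [hcont, hyx, hvu] with t ht hyt hvt
    have h := (ht.tendsto (x t, u t)).comp (hyt.prodMk_nhds hvt)
    simpa [Function.comp_def] using h.const_sub (f (x t) (u t) t)

end Caratheodory

/-- A superposition operator mapping `L^∞ × L^q` into `L^p` satisfies a growth bound of order
`q / p` on bounded sets. -/
lemma exists_growth_of_maps {X U Y : Type*}
    [NormedAddCommGroup X] [SecondCountableTopology X] [MeasurableSpace X] [BorelSpace X]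
    [NormedAddCommGroup U] [SecondCountableTopology U] [MeasurableSpace U] [BorelSpace U]
    [NormedAddCommGroup Y] {μ : Measure ℝ} [IsFiniteMeasure μ] [NullSingletonClass μ]
    {f : X → U → ℝ → Y} {p q : ℝ} (hp : 1 ≤ p) (hq : 0 < q)
    (hcont : ∀ᵐ t ∂μ, Continuous fun z : X × U => f z.1 z.2 t)
    (hmeas : ∀ (x : ℝ → X) (u : ℝ → U), AEStronglyMeasurable x μ → AEStronglyMeasurable u μ →
      AEStronglyMeasurable (fun t => f (x t) (u t) t) μ)
    (hmaps : ∀ (x : ℝ → X) (u : ℝ → U), MemLp x ⊤ μ → MemLp u (ENNReal.ofReal q) μ →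
      MemLp (fun t => f (x t) (u t) t) (ENNReal.ofReal p) μ) {R : ℝ} (hR : 0 < R) :
    ∃ C : ℝ, 0 < C ∧ ∃ ω : ℝ → ℝ, MemLp ω (ENNReal.ofReal p) μ ∧ (∀ᵐ t ∂μ, 0 ≤ ω t) ∧
      ∀ᵐ t ∂μ, ∀ (a : X) (b : U), ‖a‖ ≤ R → ‖f a b t‖ ≤ C * ‖b‖ ^ (q / p) + ω t := by
  have hp0 : 0 < p := one_pos.trans_le hp
  have : Nonempty (Metric.closedBall (0 : X) R) := ⟨⟨0, Metric.mem_closedBall_self hR.le⟩⟩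
  set s : ℕ → Metric.closedBall (0 : X) R × U := TopologicalSpace.denseSeq _ with hs
  have hsR : ∀ i, ‖((s i).1 : X)‖ ≤ R := fun i => mem_closedBall_zero_iff.1 (s i).1.2
  have hG₀ : ∀ i, AEMeasurable (fun t => ‖f (s i).1 (s i).2 t‖ₑ ^ p) μ := fun i =>
    (hmeas _ _ aestronglyMeasurable_const aestronglyMeasurable_const).enorm.pow_const p
  set G : ℕ → ℝ → ℝ≥0∞ := fun i => (hG₀ i).mk with hG
  have hGm : ∀ i, Measurable (G i) := fun i => (hG₀ i).measurable_mk
  have hGae : ∀ᵐ t ∂μ, ∀ i, ‖f (s i).1 (s i).2 t‖ₑ ^ p = G i t :=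
    ae_all_iff.2 fun i => (hG₀ i).ae_eq_mk
  obtain ⟨k, hk⟩ := exists_lintegral_iSup_sub_ne_top (μ := μ) hGm
    (c := fun i => ‖(s i).2‖ₑ ^ q) (fun i => by finiteness) (fun idx hidx hc => by
      have hx : Measurable fun t => ((s (idx t)).1 : X) :=
        (measurable_of_countable fun i => ((s i).1 : X)).comp hidx
      have hu : Measurable fun t => (s (idx t)).2 :=
        (measurable_of_countable fun i => (s i).2).comp hidx
      have h := lintegral_rpow_enorm_ne_top hp0 (hmaps _ _
        (memLp_top_of_bound hx.aestronglyMeasurable R (ae_of_all _ fun t => hsR (idx t)))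
        (memLp_of_lintegral_rpow_enorm_ne_top hq hu.aestronglyMeasurable hc))
      rwa [lintegral_congr_ae (hGae.mono fun t ht => ht (idx t))] at h)
  set h : ℝ → ℝ≥0∞ := fun t => ⨆ i, (G i t - k * ‖(s i).2‖ₑ ^ q) with hh
  have hhm : Measurable h := Measurable.iSup fun i => (hGm i).sub_const _
  refine ⟨((k : ℝ≥0∞) ^ (1 / p)).toReal + 1, by positivity, fun t => (h t ^ (1 / p)).toReal,
    memLp_toReal_rpow_inv hp0 hhm.aemeasurable hk, ae_of_all _ fun t => ENNReal.toReal_nonneg, ?_⟩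
  filter_upwards [hcont, hGae, ae_lt_top hhm hk] with t htc htG htop a b ha
  have hdense : ∀ z : Metric.closedBall (0 : X) R × U, ‖f z.1 z.2 t‖ ≤
      (((k : ℝ≥0∞) ^ (1 / p)).toReal + 1) * ‖z.2‖ ^ (q / p) + (h t ^ (1 / p)).toReal := by
    intro z₀
    refine (TopologicalSpace.denseRange_denseSeq _).induction_on
      (p := fun z : Metric.closedBall (0 : X) R × U => ‖f z.1 z.2 t‖ ≤
        (((k : ℝ≥0∞) ^ (1 / p)).toReal + 1) * ‖z.2‖ ^ (q / p) + (h t ^ (1 / p)).toReal)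
      z₀ (isClosed_le ?_ ?_) fun i => ?_
    · have h1 : Continuous fun z : Metric.closedBall (0 : X) R × U => ((z.1 : X), z.2) := by
        fun_prop
      exact (htc.comp h1).norm
    · exact (continuous_const.mul (continuous_snd.norm.rpow_const fun _ =>
        Or.inr (div_pos hq hp0).le)).add continuous_const
    · change ‖f (s i).1 (s i).2 t‖ ≤ _ * ‖(s i).2‖ ^ (q / p) + _
      have h1 : ‖f (s i).1 (s i).2 t‖ₑ ^ p ≤ h t + k * ‖(s i).2‖ₑ ^ q := by
        rw [htG i]
        exact tsub_le_iff_right.1 (le_iSup (fun i => G i t - k * ‖(s i).2‖ₑ ^ q) i)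
      have h2 : ‖f (s i).1 (s i).2 t‖ₑ ≤
          h t ^ (1 / p) + (k : ℝ≥0∞) ^ (1 / p) * ‖(s i).2‖ₑ ^ (q / p) := by
        rw [← ENNReal.le_rpow_inv_iff hp0, ← one_div] at h1
        refine h1.trans ((ENNReal.rpow_add_le_add_rpow _ _ (by positivity)
          ((div_le_one hp0).2 hp)).trans ?_)
        rw [ENNReal.mul_rpow_of_nonneg _ _ (by positivity), ← ENNReal.rpow_mul, mul_one_div]
      have hkt : (k : ℝ≥0∞) ^ (1 / p) ≠ ⊤ :=
        ENNReal.rpow_ne_top_of_nonneg (by positivity) (by finiteness)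
      have hht : h t ^ (1 / p) ≠ ⊤ := ENNReal.rpow_ne_top_of_nonneg (by positivity) htop.ne
      have hbt : ‖(s i).2‖ₑ ^ (q / p) ≠ ⊤ :=
        ENNReal.rpow_ne_top_of_nonneg (by positivity) (by finiteness)
      have h3 := ENNReal.toReal_mono (ENNReal.add_ne_top.2 ⟨hht, ENNReal.mul_ne_top hkt hbt⟩) h2
      rw [ENNReal.toReal_add hht (ENNReal.mul_ne_top hkt hbt), ENNReal.toReal_mul,
        ← ENNReal.toReal_rpow _ (q / p), toReal_enorm, toReal_enorm] at h3
      have h4 : 0 ≤ ‖(s i).2‖ ^ (q / p) := by positivity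
      linarith
  exact hdense (⟨a, mem_closedBall_zero_iff.2 ha⟩, b)

instance isFiniteMeasure_muT (T : ℝ) : IsFiniteMeasure (muT T) := by
  unfold muT; infer_instance

instance nullSingletonClass_muT (T : ℝ) : NullSingletonClass (muT T) := by
  unfold muT; infer_instance

lemma ae_muT_mem_Icc (T : ℝ) : ∀ᵐ t ∂muT T, t ∈ Icc 0 T :=
  (ae_restrict_mem measurableSet_Ioc).mono fun _ ht => Ioc_subset_Icc_self ht

namespace InW

variable {d : ℕ} {T p : ℝ} {x x' y y' : ℝ → Vec d}

lemma sub (hT : 0 ≤ T) (hx : InW T p x x') (hy : InW T p y y') :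
    InW T p (fun t => x t - y t) fun t => x' t - y' t := by
  refine ⟨hx.1.sub hy.1, fun t ht => ?_, hx.2.2.sub hy.2.2⟩
  have hsub : uIcc 0 t ⊆ uIcc 0 T := by
    rw [uIcc_of_le ht.1, uIcc_of_le hT]
    exact Icc_subset_Icc_right ht.2
  dsimp only
  rw [intervalIntegral.integral_sub (hx.1.mono_set hsub) (hy.1.mono_set hsub), hx.2.1 t ht,
    hy.2.1 t ht]
  abel

lemma continuousOn (hT : 0 ≤ T) (hx : InW T p x x') : ContinuousOn x (Icc 0 T) := by
  have h := intervalIntegral.continuousOn_primitive_interval (μ := volume) (f := x') (a := 0)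
    (b := T) (by
      rw [uIcc_of_le hT]
      exact (intervalIntegrable_iff_integrableOn_Icc_of_le hT).1 hx.1)
  rw [uIcc_of_le hT] at h
  exact (continuousOn_const.add h).congr hx.2.1

lemma aestronglyMeasurable (hT : 0 ≤ T) (hx : InW T p x x') :
    AEStronglyMeasurable x (muT T) :=
  ((hx.continuousOn hT).mono Ioc_subset_Icc_self).aestronglyMeasurable measurableSet_Ioc

lemma exists_norm_le (hT : 0 ≤ T) (hx : InW T p x x') : ∃ R, ∀ t ∈ Icc 0 T, ‖x t‖ ≤ R :=
  isCompact_Icc.exists_bound_of_continuousOn (hx.continuousOn hT)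

lemma memLp_top (hT : 0 ≤ T) (hx : InW T p x x') : MemLp x ⊤ (muT T) := by
  obtain ⟨R, hR⟩ := hx.exists_norm_le hT
  exact memLp_top_of_bound (hx.aestronglyMeasurable hT) R ((ae_muT_mem_Icc T).mono hR)

lemma enorm_le_add (hT : 0 ≤ T) (hx : InW T p x x') {s t : ℝ} (hs : s ∈ Icc 0 T)
    (ht : t ∈ Icc 0 T) : ‖x t‖ₑ ≤ ‖x s‖ₑ + eLpNorm x' 1 (muT T) := by
  have hint : ∀ r ∈ Icc 0 T, IntervalIntegrable x' volume 0 r := fun r hr => by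
    refine hx.1.mono_set ?_
    rw [uIcc_of_le hr.1, uIcc_of_le hT]
    exact Icc_subset_Icc_right hr.2
  have hsub : x t = x s + ∫ r in s..t, x' r := by
    rw [hx.2.1 t ht, hx.2.1 s hs, ← intervalIntegral.integral_add_adjacent_intervals (hint s hs)
      ((hint s hs).symm.trans (hint t ht)), add_assoc]
  calc ‖x t‖ₑ ≤ ‖x s‖ₑ + ‖∫ r in s..t, x' r‖ₑ := by rw [hsub]; exact enorm_add_le _ _
    _ ≤ ‖x s‖ₑ + eLpNorm x' 1 (muT T) := by
      gcongr
      have hE : ‖∫ r in s..t, x' r‖ₑ = ‖∫ r in uIoc s t, x' r‖ₑ := by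
        rw [← ofReal_norm, ← ofReal_norm, intervalIntegral.norm_intervalIntegral_eq]
      rw [hE, eLpNorm_one_eq_lintegral_enorm]
      refine (enorm_integral_le_lintegral_enorm _).trans (lintegral_mono_set fun r hr => ?_)
      exact ⟨(le_min hs.1 ht.1).trans_lt hr.1, hr.2.trans (max_le hs.2 ht.2)⟩

/-- The embedding of `W^{1,p}` into bounded functions. -/
lemma exists_enorm_le (d : ℕ) (hT : 0 < T) (hp : 1 ≤ p) :
    ∃ K : ℝ≥0∞, K ≠ ⊤ ∧ ∀ x x' : ℝ → Vec d, InW T p x x' → ∀ t ∈ Icc 0 T,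
      ‖x t‖ₑ ≤ K * (eLpNorm x (ENNReal.ofReal p) (muT T) +
        eLpNorm x' (ENNReal.ofReal p) (muT T)) := by
  set m := muT T univ with hm
  have hmT : m = ENNReal.ofReal T := by simp [hm, muT]
  have hm0 : m ≠ 0 := by rw [hmT]; exact (ENNReal.ofReal_pos.2 hT).ne'
  have hmt : m ≠ ⊤ := measure_ne_top _ _
  set M := m ^ (1 / (1 : ℝ≥0∞).toReal - 1 / (ENNReal.ofReal p).toReal) with hM
  have hMt : M ≠ ⊤ := ENNReal.rpow_ne_top_of_ne_zero hm0 hmt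
  have hp1 : (1 : ℝ≥0∞) ≤ ENNReal.ofReal p := ENNReal.one_le_ofReal.2 hp
  refine ⟨m⁻¹ * M + M, by finiteness, fun x x' hx t ht => ?_⟩
  have h1 : m * ‖x t‖ₑ ≤ eLpNorm x 1 (muT T) + m * eLpNorm x' 1 (muT T) := by
    calc m * ‖x t‖ₑ = ∫⁻ _, ‖x t‖ₑ ∂muT T := by rw [lintegral_const, mul_comm]
      _ ≤ ∫⁻ s, (‖x s‖ₑ + eLpNorm x' 1 (muT T)) ∂muT T :=
        lintegral_mono_ae ((ae_muT_mem_Icc T).mono fun s hs => hx.enorm_le_add hT.le hs ht)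
      _ = _ := by
        rw [lintegral_add_right _ measurable_const, lintegral_const, mul_comm m, ← hm,
          ← eLpNorm_one_eq_lintegral_enorm]
  have h2 := eLpNorm_le_eLpNorm_mul_rpow_measure_univ hp1 (hx.aestronglyMeasurable hT.le)
  have h3 := eLpNorm_le_eLpNorm_mul_rpow_measure_univ hp1 hx.2.2.1
  calc ‖x t‖ₑ = m⁻¹ * (m * ‖x t‖ₑ) := by
        rw [← mul_assoc, ENNReal.inv_mul_cancel hm0 hmt, one_mul]
    _ ≤ m⁻¹ * (eLpNorm x 1 (muT T) + m * eLpNorm x' 1 (muT T)) := by gcongr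
    _ = m⁻¹ * eLpNorm x 1 (muT T) + eLpNorm x' 1 (muT T) := by
        rw [mul_add, ← mul_assoc, ENNReal.inv_mul_cancel hm0 hmt, one_mul]
    _ ≤ m⁻¹ * (eLpNorm x (ENNReal.ofReal p) (muT T) * M) +
        eLpNorm x' (ENNReal.ofReal p) (muT T) * M := by gcongr
    _ ≤ m⁻¹ * (eLpNorm x (ENNReal.ofReal p) (muT T) * M) +
        eLpNorm x' (ENNReal.ofReal p) (muT T) * M +
        (m⁻¹ * (eLpNorm x' (ENNReal.ofReal p) (muT T) * M) +
          eLpNorm x (ENNReal.ofReal p) (muT T) * M) := le_self_add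
    _ = _ := by ring

end InW

section Interval

variable {d m : ℕ} {T p q : ℝ} {f : Vec d → Vec m → ℝ → Vec d}

lemma aestronglyMeasurable_comp_muT (hT : 0 ≤ T)
    (hfc : ContinuousOn (fun z : Vec d × Vec m × ℝ => f z.1 z.2.1 z.2.2)
      (Set.univ ×ˢ Set.univ ×ˢ Set.Icc 0 T))
    (x : ℝ → Vec d) (u : ℝ → Vec m) (hx : AEStronglyMeasurable x (muT T))
    (hu : AEStronglyMeasurable u (muT T)) :
    AEStronglyMeasurable (fun t => f (x t) (u t) t) (muT T) := by
  have hcont : Continuous fun z : Vec d × Vec m × ℝ => f z.1 z.2.1 (projIcc 0 T hT z.2.2) :=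
    hfc.comp_continuous (f := fun z : Vec d × Vec m × ℝ =>
        (z.1, z.2.1, (projIcc 0 T hT z.2.2 : ℝ))) (by fun_prop)
      fun z => ⟨mem_univ _, mem_univ _, (projIcc 0 T hT z.2.2).2⟩
  refine (hcont.comp_aestronglyMeasurable
    (hx.prodMk (hu.prodMk aestronglyMeasurable_id))).congr ?_
  filter_upwards [ae_muT_mem_Icc T] with t ht
  simp [projIcc_of_mem hT ht]

lemma ae_continuous_muT
    (hfc : ContinuousOn (fun z : Vec d × Vec m × ℝ => f z.1 z.2.1 z.2.2)
      (Set.univ ×ˢ Set.univ ×ˢ Set.Icc 0 T)) :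
    ∀ᵐ t ∂muT T, Continuous fun z : Vec d × Vec m => f z.1 z.2 t := by
  filter_upwards [ae_muT_mem_Icc T] with t ht
  exact hfc.comp_continuous (f := fun z : Vec d × Vec m => (z.1, z.2, t)) (by fun_prop)
    fun z => ⟨mem_univ _, mem_univ _, ht⟩

/-- The growth condition of order `(q/p, p)` on bounded sets of states. -/
def GrowthCondition (f : Vec d → Vec m → ℝ → Vec d) (T p q : ℝ) : Prop :=
  ∀ R : ℝ, 0 < R → ∃ C : ℝ, 0 < C ∧ ∃ ω : ℝ → ℝ,
    MemLp ω (ENNReal.ofReal p) (muT T) ∧ (∀ᵐ t ∂(muT T), 0 ≤ ω t) ∧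
    ∀ᵐ t ∂(muT T), ∀ (a : Vec d) (b : Vec m), ‖a‖ ≤ R →
      ‖f a b t‖ ≤ C * ‖b‖ ^ (q / p) + ω t

lemma GrowthCondition.memLp_comp (hT : 0 ≤ T) (hp : 0 < p) (hq : 0 < q)
    (hfc : ContinuousOn (fun z : Vec d × Vec m × ℝ => f z.1 z.2.1 z.2.2)
      (Set.univ ×ˢ Set.univ ×ˢ Set.Icc 0 T)) (hg : GrowthCondition f T p q)
    {x : ℝ → Vec d} {u : ℝ → Vec m} (hx : MemLp x ⊤ (muT T))
    (hu : MemLp u (ENNReal.ofReal q) (muT T)) :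
    MemLp (fun t => f (x t) (u t) t) (ENNReal.ofReal p) (muT T) := by
  obtain ⟨C, -, ω, hω, -, hgrowth⟩ := hg ((eLpNorm x ⊤ (muT T)).toReal + 1) (by positivity)
  refine memLp_comp_of_growth hp hq hω hgrowth ?_ hu
    (aestronglyMeasurable_comp_muT hT hfc x u hx.1 hu.1)
  filter_upwards [ae_le_eLpNormEssSup (f := x) (μ := muT T)] with t ht
  rw [← eLpNorm_exponent_top] at ht
  have h := ENNReal.toReal_mono hx.2.ne ht
  rw [toReal_enorm] at h
  linarith

/-- Convergence of states in `W^{1,p}` and of controls in `L^q`, both at a geometric rate, gives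
convergence of the compositions in `L^p`. -/
lemma GrowthCondition.tendsto_comp_sub (hT : 0 < T) (hp : 1 ≤ p) (hq : 1 ≤ q)
    (hfc : ContinuousOn (fun z : Vec d × Vec m × ℝ => f z.1 z.2.1 z.2.2)
      (Set.univ ×ˢ Set.univ ×ˢ Set.Icc 0 T)) (hg : GrowthCondition f T p q)
    {x x' : ℝ → Vec d} {u : ℝ → Vec m} (hx : InW T p x x')
    (hu : MemLp u (ENNReal.ofReal q) (muT T))
    {y y' : ℕ → ℝ → Vec d} {v : ℕ → ℝ → Vec m} (hy : ∀ n, InW T p (y n) (y' n))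
    (hv : ∀ n, MemLp (v n) (ENNReal.ofReal q) (muT T))
    (hxy : ∀ n, eLpNorm (fun t => x t - y n t) (ENNReal.ofReal p) (muT T) ≤ 2⁻¹ ^ n)
    (hxy' : ∀ n, eLpNorm (fun t => x' t - y' n t) (ENNReal.ofReal p) (muT T) ≤ 2⁻¹ ^ n)
    (huv : ∀ n, eLpNorm (fun t => u t - v n t) (ENNReal.ofReal q) (muT T) ≤ 2⁻¹ ^ n) :
    Tendsto (fun n => eLpNorm (fun t => f (x t) (u t) t - f (y n t) (v n t) t)
      (ENNReal.ofReal p) (muT T)) atTop (𝓝 0) := by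
  obtain ⟨K, hK, hKle⟩ := InW.exists_enorm_le d hT hp
  obtain ⟨R, hR⟩ := hx.exists_norm_le hT.le
  have hdist : ∀ n, ∀ t ∈ Icc 0 T, ‖x t - y n t‖ ≤ (K * 2).toReal * 2⁻¹ ^ n := fun n t ht => by
    have h1 : ‖x t - y n t‖ₑ ≤ K * 2 * 2⁻¹ ^ n := by
      refine (hKle _ _ (hx.sub hT.le (hy n)) t ht).trans ?_
      rw [mul_assoc, two_mul]
      gcongr
      · exact hxy n
      · exact hxy' n
    have h2 := ENNReal.toReal_mono (by finiteness) h1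
    simpa using h2
  have hyR : ∀ n, ∀ t ∈ Icc 0 T, ‖y n t‖ ≤ |R| + (K * 2).toReal + 1 := fun n t ht => by
    have h1 : (K * 2).toReal * 2⁻¹ ^ n ≤ (K * 2).toReal :=
      mul_le_of_le_one_right ENNReal.toReal_nonneg (pow_le_one₀ (by norm_num) (by norm_num))
    have h2 : ‖y n t‖ ≤ ‖x t‖ + ‖x t - y n t‖ := by
      simpa using norm_sub_le (x t) (x t - y n t)
    linarith [hdist n t ht, hR t ht, le_abs_self R]
  obtain ⟨C, hC, ω, hω, -, hgrowth⟩ := hg (|R| + (K * 2).toReal + 1) (by positivity)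
  refine tendsto_eLpNorm_comp_sub (one_pos.trans_le hp) hq hC.le (ae_continuous_muT hfc)
    (aestronglyMeasurable_comp_muT hT.le hfc) hω hgrowth (hx.aestronglyMeasurable hT.le)
    (fun n => (hy n).aestronglyMeasurable hT.le) ?_ ?_ ?_ hu hv huv
  · filter_upwards [ae_muT_mem_Icc T] with t ht
    linarith [hR t ht, le_abs_self R, (K * 2).toReal_nonneg]
  · filter_upwards [ae_muT_mem_Icc T] with t ht n
    exact hyR n t ht
  · filter_upwards [ae_muT_mem_Icc T] with t ht
    have h0 : Tendsto (fun n : ℕ => (K * 2).toReal * 2⁻¹ ^ n) atTop (𝓝 0) := by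
      simpa using (tendsto_pow_atTop_nhds_zero_of_lt_one (r := (2⁻¹ : ℝ)) (by norm_num)
        (by norm_num)).const_mul (K * 2).toReal
    simpa using (squeeze_zero_norm (fun n => hdist n t ht) h0).const_sub (x t)

end Interval

/-- Proposition B.3: for continuous `f`, `1 < p < ∞`, `1 ≤ q < ∞`, the Nemytskii operator
`(x,u) ↦ f(x(·),u(·),·)` maps `L^∞_d(0,T) × L^q_m(0,T)` into `L^p_d(0,T)` if and only if `f`
satisfies the growth condition of order `(q/p, p)`; moreover, in this case the operator
`F(x,u) = ẋ(·) − f(x(·),u(·),·)` is a continuous operator from `W^{1,p}_d × L^q_m` into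
`L^p_d(0,T)`. -/
theorem nemytskii_maps_iff_growth {d m : ℕ} (T : ℝ) (hT : 0 < T)
    (p q : ℝ) (hp : 1 < p) (hq : 1 ≤ q)
    (f : Vec d → Vec m → ℝ → Vec d)
    (hfc : ContinuousOn (fun z : Vec d × Vec m × ℝ => f z.1 z.2.1 z.2.2)
      (Set.univ ×ˢ Set.univ ×ˢ Set.Icc 0 T)) :
    ((∀ (x : ℝ → Vec d) (u : ℝ → Vec m), MemLp x ⊤ (muT T) →
        MemLp u (ENNReal.ofReal q) (muT T) →
        MemLp (fun t => f (x t) (u t) t) (ENNReal.ofReal p) (muT T)) ↔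
      (∀ R : ℝ, 0 < R → ∃ C : ℝ, 0 < C ∧ ∃ ω : ℝ → ℝ,
        MemLp ω (ENNReal.ofReal p) (muT T) ∧ (∀ᵐ t ∂(muT T), 0 ≤ ω t) ∧
        ∀ᵐ t ∂(muT T), ∀ (a : Vec d) (b : Vec m), ‖a‖ ≤ R →
          ‖f a b t‖ ≤ C * ‖b‖ ^ (q / p) + ω t)) ∧
    ((∀ R : ℝ, 0 < R → ∃ C : ℝ, 0 < C ∧ ∃ ω : ℝ → ℝ,
        MemLp ω (ENNReal.ofReal p) (muT T) ∧ (∀ᵐ t ∂(muT T), 0 ≤ ω t) ∧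
        ∀ᵐ t ∂(muT T), ∀ (a : Vec d) (b : Vec m), ‖a‖ ≤ R →
          ‖f a b t‖ ≤ C * ‖b‖ ^ (q / p) + ω t) →
      -- `F` maps `W^{1,p} × L^q` into `L^p` and is continuous there
      ∀ (x x' : ℝ → Vec d) (u : ℝ → Vec m), InW T p x x' →
        MemLp u (ENNReal.ofReal q) (muT T) →
        MemLp (fun t => x' t - f (x t) (u t) t) (ENNReal.ofReal p) (muT T) ∧
        ∀ ε : ℝ, 0 < ε → ∃ δ : ℝ, 0 < δ ∧
          ∀ (y y' : ℝ → Vec d) (v : ℝ → Vec m), InW T p y y' →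
            MemLp v (ENNReal.ofReal q) (muT T) →
            (eLpNorm (fun t => x t - y t) (ENNReal.ofReal p) (muT T)).toReal +
              (eLpNorm (fun t => x' t - y' t) (ENNReal.ofReal p) (muT T)).toReal +
              (eLpNorm (fun t => u t - v t) (ENNReal.ofReal q) (muT T)).toReal < δ →
            (eLpNorm (fun t => (x' t - f (x t) (u t) t) - (y' t - f (y t) (v t) t))
              (ENNReal.ofReal p) (muT T)).toReal < ε) := by
  have hp0 : 0 < p := one_pos.trans hp
  have hq0 : 0 < q := one_pos.trans_le hq
  refine ⟨⟨fun hmaps R hR => exists_growth_of_maps hp.le hq0 (ae_continuous_muT hfc)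
    (aestronglyMeasurable_comp_muT hT.le hfc) hmaps hR, fun hg x u hx hu =>
    GrowthCondition.memLp_comp hT.le hp0 hq0 hfc hg hx hu⟩, fun hg x x' u hx hu => ?_⟩
  have hF : ∀ (x x' : ℝ → Vec d) (u : ℝ → Vec m), InW T p x x' →
      MemLp u (ENNReal.ofReal q) (muT T) →
      MemLp (fun t => x' t - f (x t) (u t) t) (ENNReal.ofReal p) (muT T) :=
    fun x x' u hx hu => hx.2.2.sub
      (GrowthCondition.memLp_comp hT.le hp0 hq0 hfc hg (hx.memLp_top hT.le) hu)
  refine ⟨hF x x' u hx hu, fun ε hε => ?_⟩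
  by_contra! hcon
  choose y y' v hy hv hlt hge using fun n : ℕ => hcon ((2⁻¹ : ℝ) ^ n) (by positivity)
  have hle : ∀ (n : ℕ) (a : ℝ≥0∞), a ≠ ⊤ → a.toReal ≤ (2⁻¹ : ℝ) ^ n → a ≤ 2⁻¹ ^ n :=
    fun n a ha h => (ENNReal.toReal_le_toReal ha (by finiteness)).1 (by simpa using h)
  have hp1 : (1 : ℝ≥0∞) ≤ ENNReal.ofReal p := ENNReal.one_le_ofReal.2 hp.le
  have hxy : ∀ n, eLpNorm (fun t => x t - y n t) (ENNReal.ofReal p) (muT T) ≤ 2⁻¹ ^ n :=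
    fun n => hle n _ (((hx.sub hT.le (hy n)).memLp_top hT.le).mono_exponent le_top).2.ne (by
      linarith [hlt n, (eLpNorm (fun t => x' t - y' n t) (ENNReal.ofReal p) (muT T)).toReal_nonneg,
        (eLpNorm (fun t => u t - v n t) (ENNReal.ofReal q) (muT T)).toReal_nonneg])
  have hxy' : ∀ n, eLpNorm (fun t => x' t - y' n t) (ENNReal.ofReal p) (muT T) ≤ 2⁻¹ ^ n :=
    fun n => hle n _ (hx.2.2.sub (hy n).2.2).2.ne (by
      linarith [hlt n, (eLpNorm (fun t => x t - y n t) (ENNReal.ofReal p) (muT T)).toReal_nonneg,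
        (eLpNorm (fun t => u t - v n t) (ENNReal.ofReal q) (muT T)).toReal_nonneg])
  have huv : ∀ n, eLpNorm (fun t => u t - v n t) (ENNReal.ofReal q) (muT T) ≤ 2⁻¹ ^ n :=
    fun n => hle n _ (hu.sub (hv n)).2.ne (by
      linarith [hlt n, (eLpNorm (fun t => x t - y n t) (ENNReal.ofReal p) (muT T)).toReal_nonneg,
        (eLpNorm (fun t => x' t - y' n t) (ENNReal.ofReal p) (muT T)).toReal_nonneg])
  have hf0 := GrowthCondition.tendsto_comp_sub hT hp.le hq hfc hg hx hu hy hv hxy hxy' huv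
  have hpow : Tendsto (fun n : ℕ => (2⁻¹ : ℝ≥0∞) ^ n) atTop (𝓝 0) :=
    ENNReal.tendsto_pow_atTop_nhds_zero_of_lt_one (by simp)
  have hsum := hpow.add hf0
  rw [add_zero] at hsum
  obtain ⟨n, hn⟩ := (hsum.eventually (gt_mem_nhds (ENNReal.ofReal_pos.2 hε))).exists
  refine absurd (hge n) (not_le.2 ?_)
  have htri : eLpNorm (fun t => (x' t - f (x t) (u t) t) - (y' n t - f (y n t) (v n t) t))
      (ENNReal.ofReal p) (muT T) ≤
      2⁻¹ ^ n + eLpNorm (fun t => f (x t) (u t) t - f (y n t) (v n t) t)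
        (ENNReal.ofReal p) (muT T) := by
    have he : (fun t => (x' t - f (x t) (u t) t) - (y' n t - f (y n t) (v n t) t)) =
        (fun t => x' t - y' n t) - fun t => f (x t) (u t) t - f (y n t) (v n t) t := by
      ext1 t
      simp only [Pi.sub_apply]
      abel
    rw [he]
    refine (eLpNorm_sub_le (hx.2.2.1.sub (hy n).2.2.1) ?_ hp1).trans (by gcongr; exact hxy' n)
    exact (aestronglyMeasurable_comp_muT hT.le hfc x u (hx.aestronglyMeasurable hT.le) hu.1).sub
      (aestronglyMeasurable_comp_muT hT.le hfc _ _ ((hy n).aestronglyMeasurable hT.le) (hv n).1)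
  have h := (ENNReal.toReal_lt_toReal (ne_top_of_lt (htri.trans_lt hn)) ENNReal.ofReal_ne_top).2
    (htri.trans_lt hn)
  rwa [ENNReal.toReal_ofReal hε.le] at h
end
end

section
/- Let 1 < p < ∞ with conjugate exponent p', T > 0, and let y : (0,T)² → ℝ^{d×d} be measurable and satisfy |y(t,s)| ≤ y₀(s) for a.e. t,s ∈ (0,T), where y₀ ∈ L^{p'}(0,T) is a.e. nonnegative. Then the Volterra-type operator (K_y x)(t) = ∫_t^T y(t,s)x(s) ds defines a bounded linear operator from L^p_d(0,T) to L^p_d(0,T), the operator I − K_y is invertible, and ‖(I − K_y)^{-1}‖ ≤ ω(T, ‖y₀‖_{p'}), where ω(τ,ξ) = Σ_{n=0}^∞ (τ^n/n!)^{1/p} ξ^n defines a continuous function ω : [0,∞)×[0,∞) → [0,∞); in particular, for every n ∈ ℕ one has ‖K_y^n‖ ≤ (T^n/n!)^{1/p} ‖y₀‖_{p'}^n. -/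
open MeasureTheory Set Filter Topology
open scoped ENNReal NNReal

noncomputable section

/-- The integral operator `x ↦ (t ↦ ∫_t^T y(t,s) x(s) ds)` on functions. -/
def volterraFun {d : ℕ} (T : ℝ) (y : ℝ → ℝ → (Vec d →L[ℝ] Vec d)) (x : ℝ → Vec d) (t : ℝ) :
    Vec d :=
  ∫ s in Set.Ioc t T, y t s (x s)

/-- The `p`-th power integral of `f` on `(0, T]` with weight `t ^ k / k!`. -/
def weightedIntegral {d : ℕ} (T p : ℝ) (k : ℕ) (f : ℝ → Vec d) : ℝ≥0∞ :=
  ∫⁻ t, ENNReal.ofReal (t ^ k / k.factorial) * ‖f t‖ₑ ^ p ∂(muT T)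

section Kernel

variable {d : ℕ} {T p p' : ℝ} {y : ℝ → ℝ → (Vec d →L[ℝ] Vec d)} {y₀ : ℝ → ℝ} {x : ℝ → Vec d}

theorem stronglyMeasurable_kernel_apply
    (hymeas : StronglyMeasurable (fun st : ℝ × ℝ => y st.1 st.2)) (hx : StronglyMeasurable x) :
    StronglyMeasurable (fun st : ℝ × ℝ => y st.1 st.2 (x st.2)) :=
  isBoundedBilinearMap_apply.continuous.comp_stronglyMeasurable
    (hymeas.prodMk (hx.comp_measurable measurable_snd))

theorem stronglyMeasurable_volterraFun
    (hymeas : StronglyMeasurable (fun st : ℝ × ℝ => y st.1 st.2)) (hx : StronglyMeasurable x) :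
    StronglyMeasurable (volterraFun T y x) := by
  have hset : MeasurableSet {st : ℝ × ℝ | st.2 ∈ Set.Ioc st.1 T} :=
    (measurableSet_lt measurable_fst measurable_snd).inter
      (measurableSet_le measurable_snd measurable_const)
  have h := ((stronglyMeasurable_kernel_apply hymeas hx).indicator hset).integral_prod_right'
    (ν := (volume : Measure ℝ))
  have heq : volterraFun T y x = fun t => ∫ s, {st : ℝ × ℝ | st.2 ∈ Set.Ioc st.1 T}.indicator
      (fun st => y st.1 st.2 (x st.2)) (t, s) := by
    ext1 t
    rw [volterraFun, ← integral_indicator measurableSet_Ioc]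
    rfl
  rwa [heq]

theorem muT_restrict_Ioc {t : ℝ} (ht : 0 < t) :
    (muT T).restrict (Set.Ioc t T) = volume.restrict (Set.Ioc t T) := by
  rw [muT, Measure.restrict_restrict measurableSet_Ioc,
    Set.inter_eq_left.2 (Set.Ioc_subset_Ioc_left ht.le)]

theorem ae_muT_pos : ∀ᵐ t ∂(muT T), 0 < t ∧ t ≤ T :=
  ae_restrict_mem measurableSet_Ioc

theorem lintegral_kernel_apply_le (hp : p.HolderConjugate p')
    (hy₀ : MemLp y₀ (ENNReal.ofReal p') (muT T))
    (hbound : ∀ᵐ t ∂(muT T), ∀ᵐ s ∂(muT T), ‖y t s‖ ≤ y₀ s) (hx : StronglyMeasurable x) :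
    ∀ᵐ t ∂(muT T), ∫⁻ s in Set.Ioc t T, ‖y t s (x s)‖ₑ ≤
      eLpNorm y₀ (ENNReal.ofReal p') (muT T) *
        (∫⁻ s in Set.Ioc t T, ‖x s‖ₑ ^ p ∂(muT T)) ^ (1 / p) := by
  filter_upwards [hbound, ae_muT_pos] with t ht htpos
  rw [← muT_restrict_Ioc htpos.1]
  calc ∫⁻ s in Set.Ioc t T, ‖y t s (x s)‖ₑ ∂(muT T)
      ≤ ∫⁻ s in Set.Ioc t T, ((fun s => ‖y₀ s‖ₑ) * fun s => ‖x s‖ₑ) s ∂(muT T) := by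
        refine lintegral_mono_ae (ae_restrict_of_ae ?_)
        filter_upwards [ht] with s hs
        refine ((y t s).le_opENorm (x s)).trans (mul_le_mul_left ?_ _)
        exact enorm_le_iff_norm_le.2 (hs.trans (le_abs_self _))
    _ ≤ (∫⁻ s in Set.Ioc t T, ‖y₀ s‖ₑ ^ p' ∂(muT T)) ^ (1 / p') *
          (∫⁻ s in Set.Ioc t T, ‖x s‖ₑ ^ p ∂(muT T)) ^ (1 / p) :=
        ENNReal.lintegral_mul_le_Lp_mul_Lq _ hp.symm hy₀.1.enorm.restrict hx.enorm.aemeasurable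
    _ ≤ _ := by
        rw [eLpNorm_eq_lintegral_rpow_enorm_toReal (by simpa using hp.symm.pos)
          ENNReal.ofReal_ne_top, ENNReal.toReal_ofReal hp.symm.nonneg]
        gcongr
        · exact one_div_nonneg.2 hp.symm.nonneg
        · exact Measure.restrict_le_self

theorem weightedIntegral_zero_eq (hp : 0 < p) (f : ℝ → Vec d) :
    weightedIntegral T p 0 f = eLpNorm f (ENNReal.ofReal p) (muT T) ^ p := by
  rw [eLpNorm_eq_lintegral_rpow_enorm_toReal (by simpa using hp) ENNReal.ofReal_ne_top,
    ENNReal.toReal_ofReal hp.le, ← ENNReal.rpow_mul, one_div_mul_cancel hp.ne', ENNReal.rpow_one]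
  simp [weightedIntegral]

theorem weightedIntegral_le (k : ℕ) (f : ℝ → Vec d) :
    weightedIntegral T p k f ≤
      ENNReal.ofReal (T ^ k / k.factorial) * weightedIntegral T p 0 f := by
  rw [weightedIntegral, weightedIntegral, ← lintegral_const_mul' _ _ ENNReal.ofReal_ne_top]
  refine lintegral_mono_ae ?_
  filter_upwards [ae_muT_pos] with t ht
  have := ht.1.le
  have := ht.2
  simp only [pow_zero, Nat.factorial_zero, Nat.cast_one, div_one, ENNReal.ofReal_one, one_mul]
  gcongr

theorem lintegral_Ioo_pow_div_factorial {s : ℝ} (hs : 0 ≤ s) (k : ℕ) :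
    ∫⁻ t in Set.Ioo 0 s, ENNReal.ofReal (t ^ k / k.factorial) =
      ENNReal.ofReal (s ^ (k + 1) / (k + 1).factorial) := by
  rw [Measure.restrict_congr_set Ioo_ae_eq_Ioc, ← ofReal_integral_eq_lintegral_ofReal,
    ← intervalIntegral.integral_of_le hs, intervalIntegral.integral_div, integral_pow]
  · congr 1
    rw [Nat.factorial_succ]
    push_cast
    field_simp
    simp
  · exact (Continuous.integrableOn_Icc (by fun_prop)).mono_set Set.Ioc_subset_Icc_self
  · filter_upwards [ae_restrict_mem measurableSet_Ioc] with t ht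
    have := ht.1.le
    positivity

theorem lintegral_weight_mul_lintegral_Ioc {g : ℝ → ℝ≥0∞} (hg : Measurable g) (k : ℕ) :
    ∫⁻ t, ENNReal.ofReal (t ^ k / k.factorial) * ∫⁻ s in Set.Ioc t T, g s ∂(muT T) ∂(muT T) =
      ∫⁻ s, ENNReal.ofReal (s ^ (k + 1) / (k + 1).factorial) * g s ∂(muT T) := by
  have hw : Measurable fun t : ℝ => ENNReal.ofReal (t ^ k / k.factorial) := by fun_prop
  have hset : MeasurableSet {st : ℝ × ℝ | st.2 ∈ Set.Ioc st.1 T} :=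
    (measurableSet_lt measurable_fst measurable_snd).inter
      (measurableSet_le measurable_snd measurable_const)
  have hmeas : Measurable ({st : ℝ × ℝ | st.2 ∈ Set.Ioc st.1 T}.indicator
      fun st => ENNReal.ofReal (st.1 ^ k / k.factorial) * g st.2) :=
    ((hw.comp measurable_fst).mul (hg.comp measurable_snd)).indicator hset
  have hfin : SFinite (muT T) := by unfold muT; infer_instance
  calc _ = ∫⁻ t, ∫⁻ s, {st : ℝ × ℝ | st.2 ∈ Set.Ioc st.1 T}.indicator
        (fun st => ENNReal.ofReal (st.1 ^ k / k.factorial) * g st.2) (t, s)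
          ∂(muT T) ∂(muT T) := by
        refine lintegral_congr fun t => ?_
        rw [← lintegral_const_mul _ hg, ← lintegral_indicator measurableSet_Ioc]
        rfl
    _ = ∫⁻ s, ∫⁻ t, {st : ℝ × ℝ | st.2 ∈ Set.Ioc st.1 T}.indicator
        (fun st => ENNReal.ofReal (st.1 ^ k / k.factorial) * g st.2) (t, s)
          ∂(muT T) ∂(muT T) := lintegral_lintegral_swap hmeas.aemeasurable
    _ = _ := by
        refine lintegral_congr_ae ?_
        filter_upwards [ae_muT_pos] with s hs
        have hsub : Set.Iio s ∩ Set.Ioc 0 T = Set.Ioo 0 s := by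
          ext t
          simp only [Set.mem_inter_iff, Set.mem_Iio, Set.mem_Ioc, Set.mem_Ioo]
          constructor
          · rintro ⟨h1, h2, -⟩
            exact ⟨h2, h1⟩
          · rintro ⟨h1, h2⟩
            exact ⟨h2, h1, (h2.trans_le hs.2).le⟩
        rw [← lintegral_Ioo_pow_div_factorial hs.1.le k, ← lintegral_mul_const _ hw, ← hsub,
          ← Measure.restrict_restrict measurableSet_Iio, ← lintegral_indicator measurableSet_Iio]
        refine lintegral_congr fun t => ?_
        simp [Set.indicator_apply, hs.2]

theorem weightedIntegral_volterraFun_le (hp : p.HolderConjugate p')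
    (hy₀ : MemLp y₀ (ENNReal.ofReal p') (muT T))
    (hbound : ∀ᵐ t ∂(muT T), ∀ᵐ s ∂(muT T), ‖y t s‖ ≤ y₀ s) (hx : StronglyMeasurable x)
    (k : ℕ) :
    weightedIntegral T p k (volterraFun T y x) ≤
      eLpNorm y₀ (ENNReal.ofReal p') (muT T) ^ p * weightedIntegral T p (k + 1) x := by
  have htop : eLpNorm y₀ (ENNReal.ofReal p') (muT T) ^ p ≠ ∞ :=
    ENNReal.rpow_ne_top_of_nonneg hp.nonneg hy₀.2.ne
  have hxp : Measurable fun s => ‖x s‖ₑ ^ p := hx.enorm.pow_const p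
  rw [weightedIntegral, weightedIntegral, ← lintegral_weight_mul_lintegral_Ioc hxp,
    ← lintegral_const_mul' _ _ htop]
  refine lintegral_mono_ae ?_
  filter_upwards [lintegral_kernel_apply_le hp hy₀ hbound hx] with t ht
  rw [mul_left_comm]
  gcongr
  calc ‖volterraFun T y x t‖ₑ ^ p
      ≤ (eLpNorm y₀ (ENNReal.ofReal p') (muT T) *
        (∫⁻ s in Set.Ioc t T, ‖x s‖ₑ ^ p ∂(muT T)) ^ (1 / p)) ^ p :=
        ENNReal.rpow_le_rpow ((enorm_integral_le_lintegral_enorm _).trans ht) hp.nonneg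
    _ = _ := by
        rw [ENNReal.mul_rpow_of_nonneg _ _ hp.nonneg, ← ENNReal.rpow_mul,
          one_div_mul_cancel hp.ne_zero, ENNReal.rpow_one]

theorem memLp_volterraFun (hp : p.HolderConjugate p')
    (hymeas : StronglyMeasurable (fun st : ℝ × ℝ => y st.1 st.2))
    (hy₀ : MemLp y₀ (ENNReal.ofReal p') (muT T))
    (hbound : ∀ᵐ t ∂(muT T), ∀ᵐ s ∂(muT T), ‖y t s‖ ≤ y₀ s) (hx : StronglyMeasurable x)
    (hxp : MemLp x (ENNReal.ofReal p) (muT T)) :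
    MemLp (volterraFun T y x) (ENNReal.ofReal p) (muT T) := by
  refine ⟨(stronglyMeasurable_volterraFun hymeas hx).aestronglyMeasurable, ?_⟩
  rw [← ENNReal.rpow_lt_top_iff_of_pos hp.pos, ← weightedIntegral_zero_eq hp.pos]
  refine (weightedIntegral_volterraFun_le hp hy₀ hbound hx 0).trans_lt (ENNReal.mul_lt_top
    (ENNReal.rpow_lt_top_of_nonneg hp.nonneg hy₀.2.ne) ?_)
  refine (weightedIntegral_le _ _).trans_lt (ENNReal.mul_lt_top ENNReal.ofReal_lt_top ?_)
  rw [weightedIntegral_zero_eq hp.pos]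
  exact ENNReal.rpow_lt_top_of_nonneg hp.nonneg hxp.2.ne

theorem integrable_kernel_apply (hp : p.HolderConjugate p')
    (hymeas : StronglyMeasurable (fun st : ℝ × ℝ => y st.1 st.2))
    (hy₀ : MemLp y₀ (ENNReal.ofReal p') (muT T))
    (hbound : ∀ᵐ t ∂(muT T), ∀ᵐ s ∂(muT T), ‖y t s‖ ≤ y₀ s) (hx : StronglyMeasurable x)
    (hxp : MemLp x (ENNReal.ofReal p) (muT T)) :
    ∀ᵐ t ∂(muT T), IntegrableOn (fun s => y t s (x s)) (Set.Ioc t T) := by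
  filter_upwards [lintegral_kernel_apply_le hp hy₀ hbound hx] with t ht
  refine ⟨((stronglyMeasurable_kernel_apply hymeas hx).comp_measurable
    measurable_prodMk_left).aestronglyMeasurable, ht.trans_lt (ENNReal.mul_lt_top hy₀.2 ?_)⟩
  refine ENNReal.rpow_lt_top_of_nonneg (one_div_nonneg.2 hp.nonneg) (ne_of_lt ?_)
  refine (lintegral_mono' Measure.restrict_le_self le_rfl).trans_lt ?_
  have h := weightedIntegral_zero_eq (T := T) hp.pos x
  simp only [weightedIntegral, pow_zero, Nat.factorial_zero, Nat.cast_one, div_one,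
    ENNReal.ofReal_one, one_mul] at h
  rw [h]
  exact ENNReal.rpow_lt_top_of_nonneg hp.nonneg hxp.2.ne

theorem ae_volterraFun_congr {x' : ℝ → Vec d} (h : x =ᵐ[muT T] x') :
    volterraFun T y x =ᵐ[muT T] volterraFun T y x' := by
  filter_upwards [ae_muT_pos] with t ht
  refine integral_congr_ae ?_
  rw [← muT_restrict_Ioc ht.1]
  filter_upwards [ae_restrict_of_ae h] with s hs
  rw [hs]

theorem exists_linearMap_volterra [Fact (1 ≤ ENNReal.ofReal p)] (hp : p.HolderConjugate p')
    (hymeas : StronglyMeasurable (fun st : ℝ × ℝ => y st.1 st.2))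
    (hy₀ : MemLp y₀ (ENNReal.ofReal p') (muT T))
    (hbound : ∀ᵐ t ∂(muT T), ∀ᵐ s ∂(muT T), ‖y t s‖ ≤ y₀ s) :
    ∃ K : Lp (Vec d) (ENNReal.ofReal p) (muT T) →ₗ[ℝ] Lp (Vec d) (ENNReal.ofReal p) (muT T),
      ∀ x, K x =ᵐ[muT T] volterraFun T y x := by
  have hmem (x : Lp (Vec d) (ENNReal.ofReal p) (muT T)) :
      MemLp (volterraFun T y x) (ENNReal.ofReal p) (muT T) :=
    memLp_volterraFun hp hymeas hy₀ hbound (Lp.stronglyMeasurable x) (Lp.memLp x)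
  refine ⟨
    { toFun := fun x => MemLp.toLp _ (hmem x)
      map_add' := fun x z => ?_
      map_smul' := fun c x => ?_ }, fun x => (hmem x).coeFn_toLp⟩
  · rw [← MemLp.toLp_add, MemLp.toLp_eq_toLp_iff]
    refine (ae_volterraFun_congr (Lp.coeFn_add x z)).trans ?_
    filter_upwards [
      integrable_kernel_apply hp hymeas hy₀ hbound (Lp.stronglyMeasurable x) (Lp.memLp x),
      integrable_kernel_apply hp hymeas hy₀ hbound (Lp.stronglyMeasurable z) (Lp.memLp z)]
      with t h1 h2
    simp only [volterraFun, Pi.add_apply, map_add]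
    exact integral_add h1 h2
  · rw [RingHom.id_apply, ← MemLp.toLp_const_smul, MemLp.toLp_eq_toLp_iff]
    refine (ae_volterraFun_congr (Lp.coeFn_smul c x)).trans (Eventually.of_forall fun t => ?_)
    simp only [volterraFun, Pi.smul_apply, map_smul]
    exact integral_smul _ _

theorem weightedIntegral_congr {f g : ℝ → Vec d} (h : f =ᵐ[muT T] g) (k : ℕ) :
    weightedIntegral T p k f = weightedIntegral T p k g := by
  refine lintegral_congr_ae ?_
  filter_upwards [h] with t ht
  rw [ht]

theorem weightedIntegral_iterate_le (hp : p.HolderConjugate p')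
    (hy₀ : MemLp y₀ (ENNReal.ofReal p') (muT T))
    (hbound : ∀ᵐ t ∂(muT T), ∀ᵐ s ∂(muT T), ‖y t s‖ ≤ y₀ s)
    {K : Lp (Vec d) (ENNReal.ofReal p) (muT T) → Lp (Vec d) (ENNReal.ofReal p) (muT T)}
    (hK : ∀ x, K x =ᵐ[muT T] volterraFun T y x) (n k : ℕ)
    (x : Lp (Vec d) (ENNReal.ofReal p) (muT T)) :
    weightedIntegral T p k (K^[n] x) ≤
      (eLpNorm y₀ (ENNReal.ofReal p') (muT T) ^ p) ^ n * weightedIntegral T p (k + n) x := by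
  induction n generalizing x with
  | zero => simp
  | succ n ih =>
    rw [Function.iterate_succ_apply]
    refine (ih (K x)).trans ?_
    rw [weightedIntegral_congr (hK x), pow_succ, mul_assoc, ← add_assoc]
    gcongr
    exact weightedIntegral_volterraFun_le hp hy₀ hbound (Lp.stronglyMeasurable x) _

theorem norm_iterate_volterra_le [Fact (1 ≤ ENNReal.ofReal p)] (hT : 0 ≤ T)
    (hp : p.HolderConjugate p')
    (hy₀ : MemLp y₀ (ENNReal.ofReal p') (muT T))
    (hbound : ∀ᵐ t ∂(muT T), ∀ᵐ s ∂(muT T), ‖y t s‖ ≤ y₀ s)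
    {K : Lp (Vec d) (ENNReal.ofReal p) (muT T) → Lp (Vec d) (ENNReal.ofReal p) (muT T)}
    (hK : ∀ x, K x =ᵐ[muT T] volterraFun T y x) (n : ℕ)
    (x : Lp (Vec d) (ENNReal.ofReal p) (muT T)) :
    ‖K^[n] x‖ ≤ (T ^ n / n.factorial) ^ (1 / p) *
      ((eLpNorm y₀ (ENNReal.ofReal p') (muT T)).toReal) ^ n * ‖x‖ := by
  have h := (weightedIntegral_iterate_le hp hy₀ hbound hK n 0 x).trans
    (mul_le_mul_right (weightedIntegral_le _ _) _)
  rw [zero_add, weightedIntegral_zero_eq hp.pos, weightedIntegral_zero_eq hp.pos] at h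
  have htop : (eLpNorm y₀ (ENNReal.ofReal p') (muT T) ^ p) ^ n *
      (ENNReal.ofReal (T ^ n / n.factorial) *
        eLpNorm x (ENNReal.ofReal p) (muT T) ^ p) ≠ ∞ :=
    ENNReal.mul_ne_top (ENNReal.pow_ne_top (ENNReal.rpow_ne_top_of_nonneg hp.nonneg hy₀.2.ne))
      (ENNReal.mul_ne_top ENNReal.ofReal_ne_top
        (ENNReal.rpow_ne_top_of_nonneg hp.nonneg (Lp.eLpNorm_ne_top x)))
  have h' := ENNReal.toReal_mono htop h
  have hfac : 0 ≤ T ^ n / n.factorial := by positivity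
  rw [ENNReal.toReal_mul, ENNReal.toReal_mul, ENNReal.toReal_pow, ← ENNReal.toReal_rpow,
    ← ENNReal.toReal_rpow, ← ENNReal.toReal_rpow, ENNReal.toReal_ofReal hfac, ← Lp.norm_def,
    ← Lp.norm_def] at h'
  have hN : 0 ≤ (eLpNorm y₀ (ENNReal.ofReal p') (muT T)).toReal := ENNReal.toReal_nonneg
  refine (Real.rpow_le_rpow_iff (norm_nonneg (K^[n] x)) (by positivity) hp.pos).1 ?_
  refine h'.trans_eq ?_
  rw [Real.mul_rpow (by positivity) (norm_nonneg _), Real.mul_rpow (by positivity) (by positivity),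
    ← Real.rpow_mul hfac, one_div_mul_cancel hp.ne_zero, Real.rpow_one, Real.rpow_pow_comm hN]
  ring

end Kernel

theorem summable_rpow_pow_div_factorial_mul_pow {p τ ξ : ℝ} (hp : 0 < p) (hτ : 0 ≤ τ)
    (hξ : 0 ≤ ξ) :
    Summable fun n : ℕ => (τ ^ n / n.factorial) ^ (1 / p) * ξ ^ n := by
  rcases hτ.eq_or_lt with rfl | hτ
  · refine summable_of_ne_finset_zero (s := {0}) fun n hn => ?_
    simp only [Finset.mem_singleton] at hn
    simp [hn, hp.ne']
  rcases hξ.eq_or_lt with rfl | hξ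
  · refine summable_of_ne_finset_zero (s := {0}) fun n hn => ?_
    simp only [Finset.mem_singleton] at hn
    simp [hn]
  refine summable_of_ratio_test_tendsto_lt_one (l := 0) one_pos
    (Eventually.of_forall fun n => (by positivity)) ?_
  have hlim : Tendsto (fun n : ℕ => (τ / ((n : ℝ) + 1)) ^ (1 / p) * ξ) atTop (𝓝 0) := by
    have h1 : Tendsto (fun n : ℕ => τ / ((n : ℝ) + 1)) atTop (𝓝 0) :=
      tendsto_const_nhds.div_atTop
        (tendsto_atTop_add_const_right _ _ tendsto_natCast_atTop_atTop)
    have h2 := (h1.rpow_const (p := 1 / p) (Or.inr (by positivity))).mul_const ξ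
    rwa [Real.zero_rpow (by positivity), zero_mul] at h2
  refine hlim.congr fun n => ?_
  rw [Real.norm_of_nonneg (by positivity), Real.norm_of_nonneg (by positivity)]
  have : τ ^ (n + 1) / (n + 1).factorial = (τ / ((n : ℝ) + 1)) * (τ ^ n / n.factorial) := by
    rw [Nat.factorial_succ]
    push_cast
    field_simp
    ring
  rw [this, Real.mul_rpow (by positivity) (by positivity), pow_succ]
  have h3 : (τ ^ n / n.factorial) ^ (1 / p) ≠ 0 := (by positivity : (0 : ℝ) < _).ne'
  field_simp

theorem continuousOn_tsum_rpow_pow_div_factorial_mul_pow {p : ℝ} (hp : 0 < p) :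
    ContinuousOn (fun w : ℝ × ℝ => ∑' n : ℕ, (w.1 ^ n / n.factorial) ^ (1 / p) * w.2 ^ n)
      (Set.Ici 0 ×ˢ Set.Ici 0) := by
  refine continuousOn_of_locally_continuousOn fun w hw =>
    ⟨Set.Iio (w.1 + 1) ×ˢ Set.Iio (w.2 + 1), isOpen_Iio.prod isOpen_Iio, by simp, ?_⟩
  have h1 : 0 ≤ w.1 := hw.1
  have h2 : 0 ≤ w.2 := hw.2
  refine continuousOn_tsum (fun n => ?_) (summable_rpow_pow_div_factorial_mul_pow hp
    (τ := w.1 + 1) (ξ := w.2 + 1) (by positivity) (by positivity)) ?_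
  · refine Continuous.continuousOn (Continuous.mul ?_ (by fun_prop))
    exact Continuous.rpow_const (by fun_prop) fun _ => Or.inr (by positivity)
  · rintro n ⟨a, b⟩ ⟨⟨ha, hb⟩, ha', hb'⟩
    simp only [Set.mem_Ici, Set.mem_Iio] at ha hb ha' hb'
    rw [Real.norm_of_nonneg (by positivity)]
    dsimp only
    gcongr

/-- Lemma B.5 (resolvent of a Volterra-type integral equation): if `y(t,s)` is a measurable
matrix-valued (here: operator-valued) kernel with `|y(t,s)| ≤ y₀(s)` for an a.e. nonnegative
`y₀ ∈ L^{p'}(0,T)`, then `(K_y x)(t) = ∫_t^T y(t,s)x(s) ds` defines a bounded linear operator on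
`L^p_d(0,T)` with `‖K_y^n‖ ≤ (T^n/n!)^{1/p} ‖y₀‖_{p'}^n`, the operator `I − K_y` is invertible,
and `‖(I − K_y)^{-1}‖ ≤ ω(T,‖y₀‖_{p'})` where `ω(τ,ξ) = Σ_n (τ^n/n!)^{1/p} ξ^n` is continuous on
`[0,∞) × [0,∞)`. -/
theorem volterra_resolvent_bounded {d : ℕ} (T p p' : ℝ) (hT : 0 < T) (hp : 1 < p)
    (hconj : 1 / p + 1 / p' = 1) [Fact (1 ≤ ENNReal.ofReal p)]
    (y : ℝ → ℝ → (Vec d →L[ℝ] Vec d)) (y₀ : ℝ → ℝ)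
    (hymeas : StronglyMeasurable (fun st : ℝ × ℝ => y st.1 st.2))
    (hy₀ : MemLp y₀ (ENNReal.ofReal p') (muT T))
    (hy₀nn : ∀ᵐ s ∂(muT T), 0 ≤ y₀ s)
    (hbound : ∀ᵐ t ∂(muT T), ∀ᵐ s ∂(muT T), ‖y t s‖ ≤ y₀ s) :
    (∃ K : Lp (Vec d) (ENNReal.ofReal p) (muT T) →L[ℝ] Lp (Vec d) (ENNReal.ofReal p) (muT T),
      (∀ x : Lp (Vec d) (ENNReal.ofReal p) (muT T), ∀ᵐ t ∂(muT T),
        (K x : ℝ → Vec d) t = ∫ s in Set.Ioc t T, y t s ((x : ℝ → Vec d) s)) ∧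
      (∀ n : ℕ, ‖K ^ n‖ ≤ (T ^ n / n.factorial) ^ (1 / p) *
          ((eLpNorm y₀ (ENNReal.ofReal p') (muT T)).toReal) ^ n) ∧
      (∃ J : Lp (Vec d) (ENNReal.ofReal p) (muT T) →L[ℝ] Lp (Vec d) (ENNReal.ofReal p) (muT T),
        (1 - K) * J = 1 ∧ J * (1 - K) = 1 ∧
        ‖J‖ ≤ ∑' n : ℕ, (T ^ n / n.factorial) ^ (1 / p) *
          ((eLpNorm y₀ (ENNReal.ofReal p') (muT T)).toReal) ^ n)) ∧
    ContinuousOn (fun w : ℝ × ℝ => ∑' n : ℕ, (w.1 ^ n / n.factorial) ^ (1 / p) * w.2 ^ n)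
      (Set.Ici 0 ×ˢ Set.Ici 0) := by
  have hpq : p.HolderConjugate p' := Real.holderConjugate_iff.2 ⟨hp, by simpa using hconj⟩
  refine ⟨?_, continuousOn_tsum_rpow_pow_div_factorial_mul_pow hpq.pos⟩
  obtain ⟨L, hL⟩ := exists_linearMap_volterra hpq hymeas hy₀ hbound
  have hiter := norm_iterate_volterra_le hT.le hpq hy₀ hbound hL
  let K := L.mkContinuous _ fun x => by simpa only [Function.iterate_one] using hiter 1 x
  have hpow (n : ℕ) : ‖K ^ n‖ ≤ (T ^ n / n.factorial) ^ (1 / p) *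
      ((eLpNorm y₀ (ENNReal.ofReal p') (muT T)).toReal) ^ n := by
    refine ContinuousLinearMap.opNorm_le_bound _ (by positivity) fun x => ?_
    rw [FunLike.coe_pow_eq_iterate]
    exact hiter n x
  have hsum := summable_rpow_pow_div_factorial_mul_pow hpq.pos hT.le
    (ENNReal.toReal_nonneg (a := eLpNorm y₀ (ENNReal.ofReal p') (muT T)))
  have hK : Summable fun n => K ^ n := hsum.of_norm_bounded hpow
  exact ⟨K, hL, hpow, ∑' n, K ^ n, hK.one_sub_mul_tsum_pow, hK.tsum_pow_mul_one_sub,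
    tsum_of_norm_bounded hsum.hasSum hpow⟩
end
end
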